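/- Let d ≥ 1 and let C ⊆ ℝ^d be a closed convex cone with C ≠ {0}. Let κ : ℝ → ℂ be locally integrable and integrable on [0, +∞). For i = 1, …, n let m_i ∈ ℤ, let K_i ⊆ ℝ^d be nonempty compact convex, let C_i ⊆ C be a closed convex cone, and set P_i = K_i + C_i. For ξ ∈ ℝ^d define T(ξ) = Σ_{i=1}^n m_i · ∫_ℝ κ(t) · 1_{{t ∈ ℝ : −h_{P_i}(−ξ) ≤ t and t ≤ h_{P_i}(ξ)}}(t) dt, where support functions take values in ℝ ∪ {+∞} and an inequality against +∞ is vacuous. Then for every ξ in the topological interior of the dual cone C*, each integrand is integrable (in particular −h_{P_i}(−ξ) is finite), and T is continuous on the interior of C*. -/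

import Mathlib

open MeasureTheory Filter Set
open scoped RealInnerProductSpace Topology Pointwise

noncomputable section

/-- The support function of a set `A ⊆ ℝ^d`, with values in `ℝ ∪ {±∞}`:
`h_A(ξ) = sup_{x ∈ A} ⟪ξ, x⟫`. -/
def suppFn {d : ℕ} (A : Set (EuclideanSpace ℝ (Fin d)))
    (ξ : EuclideanSpace ℝ (Fin d)) : EReal :=
  ⨆ x ∈ A, ((⟪ξ, x⟫ : ℝ) : EReal)

theorem suppFn_eq_sSup_of_isCompact {d : ℕ} {K : Set (EuclideanSpace ℝ (Fin d))}
    (hK : IsCompact K) (hne : K.Nonempty) (ξ : EuclideanSpace ℝ (Fin d)) :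
    suppFn K ξ = ((sSup ((fun x => (⟪ξ, x⟫ : ℝ)) '' K) : ℝ) : EReal) := by
  have hcont : ContinuousOn (fun x => (⟪ξ, x⟫ : ℝ)) K := by fun_prop
  apply le_antisymm
  · refine iSup₂_le fun x hx => EReal.coe_le_coe_iff.2 ?_
    exact le_csSup (hK.bddAbove_image hcont) (mem_image_of_mem _ hx)
  · obtain ⟨x, hx, hxs⟩ := hK.exists_sSup_image_eq hne hcont
    rw [hxs]
    exact le_iSup₂ (f := fun y (_ : y ∈ K) => ((⟪ξ, y⟫ : ℝ) : EReal)) x hx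

theorem suppFn_add_eq_of_inner_nonpos {d : ℕ} {K D : Set (EuclideanSpace ℝ (Fin d))}
    {ξ : EuclideanSpace ℝ (Fin d)} (h0 : 0 ∈ D) (hD : ∀ x ∈ D, (⟪ξ, x⟫ : ℝ) ≤ 0) :
    suppFn (K + D) ξ = suppFn K ξ := by
  apply le_antisymm
  · refine iSup₂_le fun z hz => ?_
    obtain ⟨x, hx, y, hy, rfl⟩ := hz
    refine le_trans (EReal.coe_le_coe_iff.2 ?_)
      (le_iSup₂ (f := fun y (_ : y ∈ K) => ((⟪ξ, y⟫ : ℝ) : EReal)) x hx)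
    rw [inner_add_right]
    linarith [hD y hy]
  · exact biSup_mono fun x hx => ⟨x, hx, 0, h0, add_zero x⟩

theorem suppFn_add_eq_top_of_inner_pos {d : ℕ} {K D : Set (EuclideanSpace ℝ (Fin d))}
    {ξ c : EuclideanSpace ℝ (Fin d)} (hne : K.Nonempty)
    (hc : ∀ t : ℝ, 0 < t → t • c ∈ D) (hpos : 0 < (⟪ξ, c⟫ : ℝ)) :
    suppFn (K + D) ξ = ⊤ := by
  obtain ⟨x, hx⟩ := hne
  refine EReal.eq_top_iff_forall_lt _ |>.2 fun r => ?_
  set t : ℝ := (|r - ⟪ξ, x⟫| + 1) / ⟪ξ, c⟫ with ht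
  have htpos : 0 < t := by positivity
  refine lt_of_lt_of_le (EReal.coe_lt_coe_iff.2 ?_)
    (le_iSup₂ (f := fun y (_ : y ∈ K + D) => ((⟪ξ, y⟫ : ℝ) : EReal)) (x + t • c)
      ⟨x, hx, t • c, hc t htpos, rfl⟩)
  rw [inner_add_right, inner_smul_right, ht, div_mul_cancel₀ _ hpos.ne']
  linarith [le_abs_self (r - ⟪ξ, x⟫)]

theorem inner_pos_of_mem_interior_dual {d : ℕ} {C : Set (EuclideanSpace ℝ (Fin d))}
    {ξ c : EuclideanSpace ℝ (Fin d)}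
    (hξ : ξ ∈ interior {y : EuclideanSpace ℝ (Fin d) | ∀ x ∈ C, 0 ≤ ⟪y, x⟫})
    (hc : c ∈ C) (hc0 : c ≠ 0) : 0 < (⟪ξ, c⟫ : ℝ) := by
  have hlim : Tendsto (fun t : ℝ => ξ - t • c) (𝓝[>] 0) (𝓝 ξ) := by
    have : Continuous fun t : ℝ => ξ - t • c := by fun_prop
    simpa using (this.tendsto 0).mono_left nhdsWithin_le_nhds
  obtain ⟨t, ht, htpos⟩ :=
    ((hlim.eventually (mem_interior_iff_mem_nhds.1 hξ)).and self_mem_nhdsWithin).exists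
  have h := ht c hc
  rw [inner_sub_left, real_inner_smul_left] at h
  have : 0 < t * (⟪c, c⟫ : ℝ) := mul_pos htpos (real_inner_self_pos.2 hc0)
  linarith

theorem zero_mem_of_isClosed_cone {E : Type*} [AddCommGroup E] [Module ℝ E]
    [TopologicalSpace E] [ContinuousSMul ℝ E] {D : Set E} (hne : D.Nonempty)
    (hcl : IsClosed D) (hcone : ∀ t : ℝ, 0 < t → ∀ x ∈ D, t • x ∈ D) : (0 : E) ∈ D := by
  obtain ⟨x, hx⟩ := hne
  have hlim : Tendsto (fun t : ℝ => t • x) (𝓝[>] 0) (𝓝 0) := by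
    have : Continuous fun t : ℝ => t • x := by fun_prop
    simpa using (this.tendsto 0).mono_left nhdsWithin_le_nhds
  refine hcl.mem_of_tendsto hlim ?_
  filter_upwards [self_mem_nhdsWithin] with t ht using hcone t ht x hx

theorem MeasureTheory.LocallyIntegrable.integrableOn_Ici {κ : ℝ → ℂ}
    (hloc : LocallyIntegrable κ volume) {a : ℝ} (hint : IntegrableOn κ (Ici a) volume) (b : ℝ) :
    IntegrableOn κ (Ici b) volume :=
  ((hloc.integrableOn_isCompact (isCompact_Icc (a := b) (b := a))).union hint).mono_set
    fun x hx => (le_total x a).imp (fun h => ⟨hx, h⟩) id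

theorem MeasureTheory.LocallyIntegrable.continuous_integral_Icc {X : Type*} [TopologicalSpace X] {κ : ℝ → ℂ}
    (hloc : LocallyIntegrable κ volume) {a b : X → ℝ} (ha : Continuous a) (hb : Continuous b)
    (hab : ∀ x, a x ≤ b x) : Continuous fun x => ∫ t in Icc (a x) (b x), κ t := by
  have hii : ∀ u v, IntervalIntegrable κ volume u v := fun u v =>
    (hloc.integrableOn_isCompact isCompact_uIcc).intervalIntegrable
  have hprim := intervalIntegral.continuous_primitive hii 0
  have heq : (fun x => ∫ t in Icc (a x) (b x), κ t) =
      fun x => (∫ t in (0 : ℝ)..b x, κ t) - ∫ t in (0 : ℝ)..a x, κ t := by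
    funext x
    rw [intervalIntegral.integral_interval_sub_left (hii _ _) (hii _ _),
      intervalIntegral.integral_of_le (hab x), integral_Icc_eq_integral_Ioc]
  rw [heq]
  exact (hprim.comp hb).sub (hprim.comp ha)

theorem MeasureTheory.LocallyIntegrable.continuous_integral_Ici {X : Type*} [TopologicalSpace X] {κ : ℝ → ℂ}
    (hloc : LocallyIntegrable κ volume) (hint : IntegrableOn κ (Ici (0 : ℝ)) volume)
    {a : X → ℝ} (ha : Continuous a) : Continuous fun x => ∫ t in Ici (a x), κ t := by
  have hii : ∀ u v, IntervalIntegrable κ volume u v := fun u v =>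
    (hloc.integrableOn_isCompact isCompact_uIcc).intervalIntegrable
  have hprim := intervalIntegral.continuous_primitive hii 0
  have hioi : ∀ b, IntegrableOn κ (Ioi b) volume := fun b =>
    (hloc.integrableOn_Ici hint b).mono_set Ioi_subset_Ici_self
  have heq : (fun x => ∫ t in Ici (a x), κ t) =
      fun x => (∫ t in Ioi (0 : ℝ), κ t) - ∫ t in (0 : ℝ)..a x, κ t := by
    funext x
    rw [← intervalIntegral.integral_Ioi_sub_Ioi' (hioi 0) (hioi (a x)),
      integral_Ici_eq_integral_Ioi]
    ring
  rw [heq]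
  exact continuous_const.sub (hprim.comp ha)

/-- continuity on `Int(C*)` of the hybrid transform with kernel
`κ ∈ L¹_loc ∩ L¹(ℝ≥0)` of the PL-constructible function `Σ mᵢ 1_{Pᵢ}`, where each
`Pᵢ = Kᵢ + Cᵢ` with `Kᵢ` nonempty compact convex and `Cᵢ ⊆ C` a nonempty closed
convex cone. -/
theorem hybrid_transform_continuousOn_int_dual_cone
    (d : ℕ) (hd : 1 ≤ d)
    (C : Set (EuclideanSpace ℝ (Fin d)))
    (hCne : C.Nonempty) (hCclosed : IsClosed C) (hCconvex : Convex ℝ C)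
    (hCcone : ∀ t : ℝ, 0 < t → ∀ x ∈ C, t • x ∈ C)
    (hCnontriv : C ≠ {0})
    (κ : ℝ → ℂ) (hκloc : LocallyIntegrable κ volume)
    (hκint : IntegrableOn κ (Set.Ici (0 : ℝ)) volume)
    (n : ℕ)
    (m : Fin n → ℤ)
    (K Ci : Fin n → Set (EuclideanSpace ℝ (Fin d)))
    (hKne : ∀ i, (K i).Nonempty) (hKcpt : ∀ i, IsCompact (K i))
    (hKconv : ∀ i, Convex ℝ (K i))
    (hCine : ∀ i, (Ci i).Nonempty) (hCicl : ∀ i, IsClosed (Ci i))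
    (hCiconv : ∀ i, Convex ℝ (Ci i))
    (hCicone : ∀ i, ∀ t : ℝ, 0 < t → ∀ x ∈ Ci i, t • x ∈ Ci i)
    (hCiC : ∀ i, Ci i ⊆ C) :
    (∀ ξ ∈ interior {y : EuclideanSpace ℝ (Fin d) | ∀ x ∈ C, 0 ≤ ⟪y, x⟫},
      ∀ i : Fin n,
        (∃ r : ℝ, suppFn (K i + Ci i) (-ξ) = (r : EReal)) ∧
        Integrable
          (fun t => ({t : ℝ | -suppFn (K i + Ci i) (-ξ) ≤ (t : EReal) ∧
              (t : EReal) ≤ suppFn (K i + Ci i) ξ}).indicator κ t) volume) ∧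
    ContinuousOn
      (fun ξ : EuclideanSpace ℝ (Fin d) =>
        ∑ i : Fin n, (m i : ℂ) *
          ∫ t, ({t : ℝ | -suppFn (K i + Ci i) (-ξ) ≤ (t : EReal) ∧
              (t : EReal) ≤ suppFn (K i + Ci i) ξ}).indicator κ t)
      (interior {y : EuclideanSpace ℝ (Fin d) | ∀ x ∈ C, 0 ≤ ⟪y, x⟫}) := by
  set U := interior {y : EuclideanSpace ℝ (Fin d) | ∀ x ∈ C, 0 ≤ ⟪y, x⟫} with hU
  set h : Fin n → EuclideanSpace ℝ (Fin d) → ℝ :=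
    fun i ξ => sSup ((fun x => (⟪ξ, x⟫ : ℝ)) '' K i) with hh
  have hcont : ∀ i, Continuous (h i) := fun i =>
    (hKcpt i).continuous_sSup (f := fun ξ x => (⟪ξ, x⟫ : ℝ))
      (show Continuous fun p : EuclideanSpace ℝ (Fin d) × EuclideanSpace ℝ (Fin d) =>
        (⟪p.1, p.2⟫ : ℝ) from continuous_fst.inner continuous_snd)
  have hcontneg : ∀ i, Continuous fun ξ => -h i (-ξ) := fun i =>
    ((hcont i).comp continuous_neg).neg
  have hK : ∀ i ξ, suppFn (K i) ξ = (h i ξ : EReal) := fun i ξ =>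
    suppFn_eq_sSup_of_isCompact (hKcpt i) (hKne i) ξ
  have h0 : ∀ i, (0 : EuclideanSpace ℝ (Fin d)) ∈ Ci i := fun i =>
    zero_mem_of_isClosed_cone (hCine i) (hCicl i) (hCicone i)
  have hneg : ∀ ξ ∈ U, ∀ i, suppFn (K i + Ci i) (-ξ) = (h i (-ξ) : EReal) := by
    intro ξ hξ i
    rw [← hK]
    refine suppFn_add_eq_of_inner_nonpos (h0 i) fun x hx => ?_
    rw [inner_neg_left]
    exact neg_nonpos.2 (interior_subset hξ x (hCiC i hx))
  have hle : ∀ i ξ, -h i (-ξ) ≤ h i ξ := by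
    intro i ξ
    obtain ⟨x, hx⟩ := hKne i
    have hsup : ∀ η, (⟪η, x⟫ : ℝ) ≤ h i η := fun η =>
      le_csSup ((hKcpt i).bddAbove_image (by fun_prop)) (mem_image_of_mem _ hx)
    have h1 := hsup (-ξ)
    rw [inner_neg_left] at h1
    linarith [hsup ξ]
  have hset : ∀ i, (∀ ξ ∈ U, {t : ℝ | -suppFn (K i + Ci i) (-ξ) ≤ (t : EReal) ∧
        (t : EReal) ≤ suppFn (K i + Ci i) ξ} = Icc (-h i (-ξ)) (h i ξ)) ∨
      (∀ ξ ∈ U, {t : ℝ | -suppFn (K i + Ci i) (-ξ) ≤ (t : EReal) ∧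
        (t : EReal) ≤ suppFn (K i + Ci i) ξ} = Ici (-h i (-ξ))) := by
    intro i
    by_cases hCi : ∀ c ∈ Ci i, c = 0
    · left
      intro ξ hξ
      have hpos : suppFn (K i + Ci i) ξ = (h i ξ : EReal) := by
        rw [← hK]
        exact suppFn_add_eq_of_inner_nonpos (h0 i) fun x hx => by simp [hCi x hx]
      ext t
      rw [mem_ofPred_eq, hneg ξ hξ i, hpos, ← EReal.coe_neg, EReal.coe_le_coe_iff,
        EReal.coe_le_coe_iff, mem_Icc]
    · right
      push Not at hCi
      obtain ⟨c, hc, hc0⟩ := hCi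
      intro ξ hξ
      have htop : suppFn (K i + Ci i) ξ = ⊤ :=
        suppFn_add_eq_top_of_inner_pos (hKne i) (fun t ht => hCicone i t ht c hc)
          (inner_pos_of_mem_interior_dual hξ (hCiC i hc) hc0)
      ext t
      rw [mem_ofPred_eq, hneg ξ hξ i, htop, ← EReal.coe_neg, EReal.coe_le_coe_iff, mem_Ici]
      simp
  refine ⟨fun ξ hξ i => ⟨⟨_, hneg ξ hξ i⟩, ?_⟩, ?_⟩
  · rcases hset i with hs | hs
    · rw [hs ξ hξ]
      exact (integrable_indicator_iff measurableSet_Icc).2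
        (hκloc.integrableOn_isCompact isCompact_Icc)
    · rw [hs ξ hξ]
      exact (integrable_indicator_iff measurableSet_Ici).2
        (hκloc.integrableOn_Ici hκint _)
  · refine continuousOn_finsetSum _ fun i _ => continuousOn_const.mul ?_
    rcases hset i with hs | hs
    · refine (hκloc.continuous_integral_Icc (hcontneg i) (hcont i)
        (hle i)).continuousOn.congr fun ξ hξ => ?_
      simp only [hs ξ hξ]
      exact integral_indicator measurableSet_Icc
    · refine (hκloc.continuous_integral_Ici hκint (hcontneg i)).continuousOn.congr
        fun ξ hξ => ?_
      simp only [hs ξ hξ]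
      exact integral_indicator measurableSet_Ici
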